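/- Let H be a complex Hilbert space with dim H ≥ 2. Then there is no function v from the set of orthogonal projections on H to {0,1} satisfying, for all orthogonal projections P and Q: v(P ∨ Q) = max(v(P), v(Q)), v(P ∧ Q) = min(v(P), v(Q)), and v(P^⊥) = 1 − v(P). That is, no classical admissible valuation (lattice homomorphism to the two-element Boolean algebra B₂) exists on the projection lattice of H. -/

import Mathlib

noncomputable section

variable {H : Type*} [NormedAddCommGroup H] [InnerProductSpace ℂ H] [CompleteSpace H]

/-- An orthogonal projection: an idempotent, self-adjoint bounded operator. -/
def IsOrthoProj (P : H →L[ℂ] H) : Prop := IsIdempotentElem P ∧ IsSelfAdjoint P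

/-- The range of a bounded operator, as a submodule. -/
def rng (P : H →L[ℂ] H) : Submodule ℂ H := LinearMap.range (P : H →ₗ[ℂ] H)

/-- Vectors supported (in the Hilbert basis `b`) on `s`. -/
def suppK {κ : Type*} (b : HilbertBasis κ ℂ H) (s : Set κ) : Submodule ℂ H where
  carrier := {x | ∀ i, i ∉ s → inner ℂ (b i) x = 0}
  zero_mem' := by intro i _; simp
  add_mem' := by
    intro x y hx hy i hi
    rw [inner_add_right, hx i hi, hy i hi, add_zero]
  smul_mem' := by
    intro c x hx i hi
    rw [inner_smul_right, hx i hi, mul_zero]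

/-- Vectors with `σ`-symmetric coordinates. -/
def symK {κ : Type*} (b : HilbertBasis κ ℂ H) (σ : κ → κ) : Submodule ℂ H where
  carrier := {x | ∀ i, inner ℂ (b (σ i)) x = inner ℂ (b i) x}
  zero_mem' := by intro i; simp
  add_mem' := by
    intro x y hx hy i
    rw [inner_add_right, inner_add_right, hx i, hy i]
  smul_mem' := by
    intro c x hx i
    rw [inner_smul_right, inner_smul_right, hx i]

lemma mem_suppK {κ : Type*} (b : HilbertBasis κ ℂ H) (s : Set κ) (x : H) :
    x ∈ suppK b s ↔ ∀ i, i ∉ s → inner ℂ (b i) x = 0 := Iff.rfl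

lemma mem_symK {κ : Type*} (b : HilbertBasis κ ℂ H) (σ : κ → κ) (x : H) :
    x ∈ symK b σ ↔ ∀ i, inner ℂ (b (σ i)) x = inner ℂ (b i) x := Iff.rfl

lemma isClosed_suppK {κ : Type*} (b : HilbertBasis κ ℂ H) (s : Set κ) :
    IsClosed (suppK b s : Set H) := by
  have : (suppK b s : Set H) = ⋂ i, ⋂ (_ : i ∉ s), {x | inner ℂ (b i) x = 0} := by
    ext x; simp [mem_suppK]
  rw [this]
  refine isClosed_iInter fun i => isClosed_iInter fun _ => ?_
  exact isClosed_eq (by fun_prop) (by fun_prop)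

lemma isClosed_symK {κ : Type*} (b : HilbertBasis κ ℂ H) (σ : κ → κ) :
    IsClosed (symK b σ : Set H) := by
  have : (symK b σ : Set H) = ⋂ i, {x | inner ℂ (b (σ i)) x = inner ℂ (b i) x} := by
    ext x; simp [mem_symK]
  rw [this]
  refine isClosed_iInter fun i => ?_
  exact isClosed_eq (by fun_prop) (by fun_prop)

lemma basis_inner {κ : Type*} (b : HilbertBasis κ ℂ H) {i j : κ} (h : i ≠ j) :
    inner ℂ (b i) (b j) = 0 := b.orthonormal.2 h

lemma basis_inner_self {κ : Type*} (b : HilbertBasis κ ℂ H) (i : κ) :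
    inner ℂ (b i) (b i) = 1 := by
  rw [inner_self_eq_norm_sq_to_K, b.orthonormal.1 i]; simp

lemma basis_mem {κ : Type*} (b : HilbertBasis κ ℂ H) {s : Set κ} {i : κ} (h : i ∈ s) :
    b i ∈ suppK b s := by
  intro j hj
  apply basis_inner
  rintro rfl
  exact hj h

lemma eq_zero_of_inner {κ : Type*} (b : HilbertBasis κ ℂ H) (x : H)
    (h : ∀ i, inner ℂ (b i) x = 0) : x = 0 := by
  have h1 := b.hasSum_repr x
  have h2 : (fun i => b.repr x i • b i) = fun _ => (0 : H) := by
    funext i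
    rw [b.repr_apply_apply, h i, zero_smul]
  rw [h2] at h1
  exact h1.unique hasSum_zero

lemma suppK_le {κ : Type*} (b : HilbertBasis κ ℂ H) (s : Set κ) (M : Submodule ℂ H)
    (h : ∀ i ∈ s, b i ∈ M) : suppK b s ≤ M.topologicalClosure := by
  intro x hx
  have h1 := b.hasSum_repr x
  refine M.isClosed_topologicalClosure.mem_of_tendsto h1 (Filter.Eventually.of_forall ?_)
  intro F
  refine Submodule.sum_mem _ fun i _ => ?_
  by_cases hi : i ∈ s
  · exact Submodule.smul_mem _ _ (M.le_topologicalClosure (h i hi))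
  · rw [b.repr_apply_apply, hx i hi, zero_smul]
    exact Submodule.zero_mem _

lemma suppK_mono {κ : Type*} (b : HilbertBasis κ ℂ H) {s t : Set κ} (h : s ⊆ t) :
    suppK b s ≤ suppK b t := fun _ hx i hi => hx i fun h' => hi (h h')

lemma closure_sup_eq {κ : Type*} (b : HilbertBasis κ ℂ H) (s : Set κ) (M N : Submodule ℂ H)
    (hM : M ≤ suppK b s) (hN : N ≤ suppK b s) (h : ∀ i ∈ s, b i ∈ M ⊔ N) :
    (M ⊔ N).topologicalClosure = suppK b s :=
  le_antisymm (Submodule.topologicalClosure_minimal _ (sup_le hM hN) (isClosed_suppK b s))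
    (suppK_le b s _ h)

lemma suppK_sup {κ : Type*} (b : HilbertBasis κ ℂ H) (s t : Set κ) :
    (suppK b s ⊔ suppK b t).topologicalClosure = suppK b (s ∪ t) := by
  refine closure_sup_eq b _ _ _ (suppK_mono b Set.subset_union_left)
    (suppK_mono b Set.subset_union_right) ?_
  rintro i (hi | hi)
  · exact Submodule.mem_sup_left (basis_mem b hi)
  · exact Submodule.mem_sup_right (basis_mem b hi)

lemma sym_mem {κ : Type*} (b : HilbertBasis κ ℂ H) (σ : κ → κ) (hσ : ∀ i, σ (σ i) = i)
    (i : κ) : b i + b (σ i) ∈ symK b σ := by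
  classical
  have key : ∀ j k, inner ℂ (b j) (b k) = if j = k then (1 : ℂ) else 0 := by
    intro j k
    split_ifs with h
    · rw [h, basis_inner_self]
    · exact basis_inner b h
  intro k
  have e1 : (σ k = i) ↔ (k = σ i) := ⟨fun h => by rw [← h, hσ], fun h => by rw [h, hσ]⟩
  have e2 : (σ k = σ i) ↔ (k = i) := ⟨fun h => by rw [← hσ k, h, hσ], fun h => by rw [h]⟩
  simp only [inner_add_right, key, e1, e2]
  rw [add_comm]

lemma sym_join {κ : Type*} (b : HilbertBasis κ ℂ H) (σ : κ → κ) (hσ : ∀ i, σ (σ i) = i)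
    (s t : Set κ) (ht : ∀ i ∈ t, σ i ∈ s) :
    (suppK b s ⊔ (symK b σ ⊓ suppK b (s ∪ t))).topologicalClosure = suppK b (s ∪ t) := by
  refine closure_sup_eq b _ _ _ (suppK_mono b Set.subset_union_left) inf_le_right ?_
  rintro i (hi | hi)
  · exact Submodule.mem_sup_left (basis_mem b hi)
  · have h1 : b (σ i) ∈ suppK b s := basis_mem b (ht i hi)
    have h2 : b i + b (σ i) ∈ symK b σ ⊓ suppK b (s ∪ t) :=
      ⟨sym_mem b σ hσ i, Submodule.add_mem _ (basis_mem b (Or.inr hi))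
        (basis_mem b (Or.inl (ht i hi)))⟩
    have h3 : b i = (b i + b (σ i)) - b (σ i) := by abel
    rw [h3]
    exact Submodule.sub_mem _ (Submodule.mem_sup_right h2) (Submodule.mem_sup_left h1)

lemma sym_meet {κ : Type*} (b : HilbertBasis κ ℂ H) (σ : κ → κ)
    (s t : Set κ) (hd : Disjoint s t) (hs : ∀ i ∈ s, σ i ∈ t) :
    suppK b s ⊓ (symK b σ ⊓ suppK b (s ∪ t)) = ⊥ := by
  rw [eq_bot_iff]
  rintro x ⟨h1, h2, -⟩
  refine (Submodule.mem_bot ℂ).2 (eq_zero_of_inner b x fun i => ?_)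
  by_cases hi : i ∈ s
  · rw [← h2 i]
    exact h1 _ fun h => Set.disjoint_left.1 hd h (hs i hi)
  · exact h1 i hi

lemma suppK_meet {κ : Type*} (b : HilbertBasis κ ℂ H) (s t : Set κ) (hd : Disjoint s t) :
    suppK b s ⊓ suppK b t = ⊥ := by
  rw [eq_bot_iff]
  rintro x ⟨h1, h2⟩
  refine (Submodule.mem_bot ℂ).2 (eq_zero_of_inner b x fun i => ?_)
  by_cases hi : i ∈ s
  · exact h2 _ fun h => Set.disjoint_left.1 hd hi h
  · exact h1 i hi

/-- The diamond argument. -/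
lemma pair_zero {κ : Type*} (b : HilbertBasis κ ℂ H) (w : Submodule ℂ H → ℝ)
    (hbot : w ⊥ = 0)
    (hsup : ∀ K L : Submodule ℂ H, IsClosed (K : Set H) → IsClosed (L : Set H) →
      w (K ⊔ L).topologicalClosure = max (w K) (w L))
    (hinf : ∀ K L : Submodule ℂ H, IsClosed (K : Set H) → IsClosed (L : Set H) →
      w (K ⊓ L) = min (w K) (w L))
    (σ : κ → κ) (hσ : ∀ i, σ (σ i) = i) (s t : Set κ) (hd : Disjoint s t)
    (hs : ∀ i ∈ s, σ i ∈ t) (ht : ∀ i ∈ t, σ i ∈ s) : w (suppK b (s ∪ t)) = 0 := by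
  have cs := isClosed_suppK b s
  have ct := isClosed_suppK b t
  have cr : IsClosed ((symK b σ ⊓ suppK b (s ∪ t) : Submodule ℂ H) : Set H) :=
    (isClosed_symK b σ).inter (isClosed_suppK b (s ∪ t))
  have a1 := hsup _ _ cs ct
  have a2 := hsup _ _ cs cr
  have a3 := hsup _ _ ct cr
  have m1 := hinf _ _ cs ct
  have m2 := hinf _ _ cs cr
  have m3 := hinf _ _ ct cr
  rw [suppK_sup] at a1
  rw [sym_join b σ hσ s t ht] at a2
  rw [Set.union_comm s t, sym_join b σ hσ t s hs] at a3
  rw [suppK_meet b s t hd, hbot] at m1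
  rw [sym_meet b σ s t hd hs, hbot] at m2
  rw [Set.union_comm s t, sym_meet b σ t s hd.symm ht, hbot] at m3
  rw [Set.union_comm t s] at a3 m3
  grind

lemma no_w (hdim : 2 ≤ Module.rank ℂ H) (w : Submodule ℂ H → ℝ)
    (hbot : w ⊥ = 0) (htop : w ⊤ = 1)
    (h01 : ∀ K : Submodule ℂ H, IsClosed (K : Set H) → w K = 0 ∨ w K = 1)
    (hsup : ∀ K L : Submodule ℂ H, IsClosed (K : Set H) → IsClosed (L : Set H) →
      w (K ⊔ L).topologicalClosure = max (w K) (w L))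
    (hinf : ∀ K L : Submodule ℂ H, IsClosed (K : Set H) → IsClosed (L : Set H) →
      w (K ⊓ L) = min (w K) (w L)) : False := by
  classical
  obtain ⟨κ, b, -⟩ := exists_hilbertBasis ℂ H
  have huniv : suppK b Set.univ = ⊤ := by
    rw [eq_top_iff]
    intro x _ i hi
    exact absurd (Set.mem_univ i) hi
  have hpair := pair_zero b w hbot hsup hinf
  suffices h : w (suppK b Set.univ) = 0 by
    rw [huniv, htop] at h
    exact one_ne_zero h
  rcases finite_or_infinite κ with hf | hinfi
  · have hnt : Nontrivial κ := by
      by_contra hn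
      rw [not_nontrivial_iff_subsingleton] at hn
      have hsub : ∀ i : κ, (⊤ : Submodule ℂ H) ≤ Submodule.span ℂ {b i} := by
        intro i x _
        have h1 := b.hasSum_repr x
        have h2 := hasSum_single (f := fun j => b.repr x j • b j) i
          (fun j hj => absurd (Subsingleton.elim j i) hj)
        rw [h1.unique h2]
        exact Submodule.smul_mem _ _ (Submodule.mem_span_singleton_self _)
      have hr : Module.rank ℂ H ≤ 1 := by
        rcases isEmpty_or_nonempty κ with he | ⟨⟨i⟩⟩
        · have : Subsingleton H := ⟨fun x y => by
            rw [eq_zero_of_inner b x (fun i => he.elim i),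
              eq_zero_of_inner b y (fun i => he.elim i)]⟩
          rw [rank_subsingleton']
          exact zero_le_one
        · rw [← rank_top]
          refine (Submodule.rank_mono (hsub i)).trans ?_
          exact (rank_span_le _).trans (by simp)
      have := hdim.trans hr
      norm_num at this
    have hsing : ∀ i : κ, w (suppK b {i}) = 0 := by
      intro i
      obtain ⟨j, hj⟩ := exists_ne i
      have h1 := hpair (Equiv.swap i j) (by simp) {i} {j}
        (by simpa using hj.symm) (by simp) (by simp)
      have h2 := hsup _ _ (isClosed_suppK b {i}) (isClosed_suppK b {j})
      rw [suppK_sup, h1] at h2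
      have h3 := h01 _ (isClosed_suppK b {i})
      have h4 := le_max_left (w (suppK b {i})) (w (suppK b {j}))
      rcases h3 with h3 | h3
      · exact h3
      · linarith
    have hfin : ∀ s : Set κ, s.Finite → w (suppK b s) = 0 := by
      intro s hs
      induction s, hs using Set.Finite.induction_on with
      | empty =>
        have : suppK b (∅ : Set κ) = ⊥ := by
          rw [eq_bot_iff]
          intro x hx
          exact (Submodule.mem_bot ℂ).2 (eq_zero_of_inner b x fun i => hx i (by simp))
        rw [this, hbot]
      | @insert i s _ _ ih =>
        have h2 := hsup _ _ (isClosed_suppK b {i}) (isClosed_suppK b s)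
        rw [suppK_sup, ih, hsing, max_self] at h2
        rw [Set.insert_eq]
        exact h2
    exact hfin _ Set.finite_univ
  · have hcard : Nonempty (κ ≃ κ ⊕ κ) := by
      rw [← Cardinal.eq, Cardinal.mk_sum, Cardinal.lift_id,
        Cardinal.add_eq_self (Cardinal.aleph0_le_mk _)]
    obtain ⟨e⟩ := hcard
    have h := hpair (fun i => e.symm (e i).swap) (by simp)
      {i | (e i).isLeft = true} {i | (e i).isRight = true}
      (by
        rw [Set.disjoint_left]
        intro i h1 h2
        simp only [Set.mem_setOf_eq] at h1 h2
        cases h : e i <;> simp_all) (by simp) (by simp)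
    have hu : {i | (e i).isLeft = true} ∪ {i | (e i).isRight = true} = Set.univ := by
      ext i
      cases h : e i <;> simp [h]
    rwa [hu] at h

/-- The orthogonal projection onto a closed submodule, zero on others. -/
lemma exists_proj (K : Submodule ℂ H) (hK : IsClosed (K : Set H)) :
    ∃ P : H →L[ℂ] H, IsOrthoProj P ∧ rng P = K := by
  have : CompleteSpace K := hK.completeSpace_coe
  exact ⟨K.starProjection, ⟨K.isIdempotentElem_starProjection, isSelfAdjoint_starProjection K⟩,
    K.range_starProjection⟩

/-- If `dim H ≥ 2`, there is no `{0,1}`-valued function on the orthogonal projections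
of `H` that is a lattice homomorphism to the two-element Boolean algebra:
`v (P ∨ Q) = max (v P) (v Q)`, `v (P ∧ Q) = min (v P) (v Q)` and `v Pᗮ = 1 - v P`.
Here `P ∨ Q` is the orthogonal projection `R` whose range is the closure of the sum of
the ranges of `P` and `Q`, `P ∧ Q` is the projection whose range is the intersection of
the ranges, and `Pᗮ = 1 - P`. -/
theorem no_classical_admissible_valuation (hdim : 2 ≤ Module.rank ℂ H) :
    ¬ ∃ v : (H →L[ℂ] H) → ℝ,
        (∀ P, IsOrthoProj P → v P = 0 ∨ v P = 1) ∧
        (∀ P Q R, IsOrthoProj P → IsOrthoProj Q → IsOrthoProj R →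
          rng R = (rng P ⊔ rng Q).topologicalClosure → v R = max (v P) (v Q)) ∧
        (∀ P Q R, IsOrthoProj P → IsOrthoProj Q → IsOrthoProj R →
          rng R = rng P ⊓ rng Q → v R = min (v P) (v Q)) ∧
        (∀ P, IsOrthoProj P → v (1 - P) = 1 - v P) := by
  rintro ⟨v, h01, hsup, hinf, hneg⟩
  classical
  choose! p hp hpr using exists_proj (H := H)
  have c0 : IsOrthoProj (0 : H →L[ℂ] H) := ⟨by simp [IsIdempotentElem], by simp⟩
  have c1 : IsOrthoProj (1 : H →L[ℂ] H) := ⟨by simp [IsIdempotentElem], by simp⟩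
  have r0 : rng (0 : H →L[ℂ] H) = ⊥ := by simp [rng]
  have r1 : rng (1 : H →L[ℂ] H) = ⊤ := by
    rw [eq_top_iff]
    exact fun x _ => ⟨x, rfl⟩
  have hv1 : v 1 = 1 - v 0 := by simpa using hneg 0 c0
  have hm := hinf 0 1 0 c0 c1 c0 (by rw [r0, bot_inf_eq])
  have hv0 : v 0 = 0 := by
    rcases h01 0 c0 with h | h
    · exact h
    · rw [hv1, h] at hm; norm_num at hm
  have huniq : ∀ P Q : H →L[ℂ] H, IsOrthoProj P → IsOrthoProj Q → rng P = rng Q →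
      v P = v Q := by
    intro P Q hP hQ h
    have := hinf Q Q P hQ hQ hP (by rw [h, inf_idem])
    rwa [min_self] at this
  have cb : IsClosed ((⊥ : Submodule ℂ H) : Set H) := by simp
  have ct : IsClosed ((⊤ : Submodule ℂ H) : Set H) := by simp
  refine no_w hdim (fun K => v (p K)) ?_ ?_ ?_ ?_ ?_
  · exact (huniq _ _ (hp _ cb) c0 (by rw [hpr _ cb, r0])).trans hv0
  · refine (huniq _ _ (hp _ ct) c1 (by rw [hpr _ ct, r1])).trans ?_
    rw [hv1, hv0, sub_zero]
  · exact fun K hK => h01 _ (hp K hK)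
  · intro K L hK hL
    have hc := (K ⊔ L).isClosed_topologicalClosure
    exact hsup _ _ _ (hp K hK) (hp L hL) (hp _ hc) (by rw [hpr _ hc, hpr K hK, hpr L hL])
  · intro K L hK hL
    have hc : IsClosed ((K ⊓ L : Submodule ℂ H) : Set H) := hK.inter hL
    exact hinf _ _ _ (hp K hK) (hp L hL) (hp _ hc) (by rw [hpr _ hc, hpr K hK, hpr L hL])
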